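/- arXiv:2301.12929 — 9 statements merged into one kernel-verified Lean document; each statement's English description precedes it below -/
import Mathlib

section
/- For every m ∈ ℝ and every a ≥ m, the Gaussian upper-tail probability is monotone nondecreasing in the variance: if 0 < v₁ ≤ v₂ then N(m, v₁)((a, ∞)) ≤ N(m, v₂)((a, ∞)). -/
open MeasureTheory ProbabilityTheory

/-- Dilating a Gaussian by `c` about its mean multiplies its variance by `c ^ 2`. -/
lemma gaussianReal_map_dilation_mean (m : ℝ) (v c : NNReal) :
    (gaussianReal m v).map (fun x ↦ (c : ℝ) * (x - m) + m) = gaussianReal m (c ^ 2 * v) := by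
  have h : (fun x : ℝ ↦ (c : ℝ) * (x - m) + m) =
      (fun x ↦ x + m) ∘ (fun x ↦ (c : ℝ) * x) ∘ (fun x ↦ x - m) := rfl
  rw [h, ← Measure.map_map (by fun_prop) (by fun_prop),
    ← Measure.map_map (by fun_prop) (by fun_prop), gaussianReal_map_sub_const,
    gaussianReal_map_const_mul, gaussianReal_map_add_const]
  congr 1
  simp

theorem gaussian_tail_mono_in_variance_of_ge_mean (m : ℝ) (a : ℝ) (ha : m ≤ a)
    (v₁ v₂ : NNReal) (hv₁ : 0 < v₁) (hv₁₂ : v₁ ≤ v₂) :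
    gaussianReal m v₁ (Set.Ioi a) ≤ gaussianReal m v₂ (Set.Ioi a) := by
  set c : NNReal := NNReal.sqrt (v₂ / v₁)
  have hc : 1 ≤ (c : ℝ) := by
    exact_mod_cast NNReal.one_le_sqrt.mpr ((one_le_div hv₁).mpr hv₁₂)
  have hv₂ : c ^ 2 * v₁ = v₂ := by
    rw [NNReal.sq_sqrt, div_mul_cancel₀ _ hv₁.ne']
  rw [← hv₂, ← gaussianReal_map_dilation_mean m v₁ c,
    Measure.map_apply (by fun_prop) measurableSet_Ioi]
  refine measure_mono fun x hx ↦ ?_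
  simp only [Set.mem_preimage, Set.mem_Ioi] at hx ⊢
  nlinarith [mul_nonneg (sub_nonneg.mpr hc) (sub_nonneg.mpr (ha.trans hx.le))]
end

section
/- Fix m⁺ ∈ ℝ and v⁺, v⁻ > 0. The map m ↦ PERM(N(m⁺, v⁺), N(m, v⁻)) is strictly increasing: if m₁ < m₂ then PERM(N(m⁺, v⁺), N(m₁, v⁻)) < PERM(N(m⁺, v⁺), N(m₂, v⁻)). -/
open MeasureTheory ProbabilityTheory

/-- Expected rank of a score `a`: the mass the negative-score distribution puts above `a`. -/
noncomputable def ER (μn : Measure ℝ) (a : ℝ) : ENNReal := μn (Set.Ioi a)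

/-- Proxy expected ranking metric. -/
noncomputable def PERM (μp μn : Measure ℝ) : ENNReal := ∫⁻ x, ER μn x ∂μp

theorem antitone_ER (μ : Measure ℝ) : Antitone (ER μ) := fun _ _ hab =>
  measure_mono (Set.Ioi_subset_Ioi hab)

theorem ER_gaussianReal_eq_ER_sub (m : ℝ) (v : NNReal) (a : ℝ) :
    ER (gaussianReal m v) a = ER (gaussianReal 0 v) (a - m) := by
  unfold ER
  rw [show gaussianReal m v = (gaussianReal 0 v).map (· + m) by
      rw [gaussianReal_map_add_const, zero_add],
    Measure.map_apply (measurable_add_const m) measurableSet_Ioi, Set.preimage_add_const_Ioi]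

theorem strictAnti_ER_gaussianReal (m : ℝ) {v : NNReal} (hv : v ≠ 0) :
    StrictAnti (ER (gaussianReal m v)) := by
  intro a b hab
  have hpos : gaussianReal m v (Set.Ioc a b) ≠ 0 := fun h0 => by
    have := gaussianReal_absolutelyContinuous' m hv h0
    simp [Real.volume_Ioc, hab.not_ge] at this
  unfold ER
  rw [← Set.Ioc_union_Ioi_eq_Ioi hab.le,
    measure_union (Set.Ioc_disjoint_Ioi le_rfl) measurableSet_Ioi, add_comm]
  exact ENNReal.lt_add_right (measure_ne_top _ _) hpos

theorem PERM_lt_PERM {μ ν₁ ν₂ : Measure ℝ} [IsProbabilityMeasure μ] [IsFiniteMeasure ν₁]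
    (h : ∀ x, ER ν₁ x < ER ν₂ x) : PERM μ ν₁ < PERM μ ν₂ := by
  refine lintegral_strict_mono (IsProbabilityMeasure.ne_zero μ)
    (antitone_ER ν₂).measurable.aemeasurable ?_ (.of_forall h)
  refine ((lintegral_mono fun x => measure_mono (Set.subset_univ (Set.Ioi x))).trans_lt
    (?_ : ∫⁻ _, ν₁ Set.univ ∂μ < ⊤)).ne
  simp

theorem perm_strictMono_in_negative_mean (mp : ℝ) (vp vn : NNReal)
    (hvp : 0 < vp) (hvn : 0 < vn) (m₁ m₂ : ℝ) (h : m₁ < m₂) :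
    PERM (gaussianReal mp vp) (gaussianReal m₁ vn) <
      PERM (gaussianReal mp vp) (gaussianReal m₂ vn) := by
  refine PERM_lt_PERM fun x => ?_
  rw [ER_gaussianReal_eq_ER_sub m₁, ER_gaussianReal_eq_ER_sub m₂]
  exact strictAnti_ER_gaussianReal 0 hvn.ne' (sub_lt_sub_left h x)
end

section
/- Fix m⁺, m⁻ ∈ ℝ with m⁻ ≥ m⁺. Then PERM(N(m⁺, v⁺), N(m⁻, v⁻)) is monotone nonincreasing in the negative-score variance v⁻ and in the positive-score variance v⁺: if 0 < v₁ ≤ v₂ then PERM(N(m⁺, v⁺), N(m⁻, v₂)) ≤ PERM(N(m⁺, v⁺), N(m⁻, v₁)) and PERM(N(m⁺, v₂), N(m⁻, v⁻)) ≤ PERM(N(m⁺, v₁), N(m⁻, v⁻)) for any fixed v⁺, v⁻ > 0. -/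
open MeasureTheory ProbabilityTheory

open scoped NNReal in
lemma PERM_gaussianReal (mp mn : ℝ) (vp vn : ℝ≥0) :
    PERM (gaussianReal mp vp) (gaussianReal mn vn) =
      gaussianReal (mn - mp) (vn + vp) (Set.Ioi 0) := by
  have hconv : gaussianReal (mn - mp) (vn + vp) =
      Measure.conv ((gaussianReal mp vp).map fun x ↦ -x) (gaussianReal mn vn) := by
    rw [gaussianReal_map_neg, gaussianReal_conv_gaussianReal, add_comm vn, neg_add_eq_sub]
  have hmeas : Measurable ((Set.Ioi (0 : ℝ)).indicator (1 : ℝ → ENNReal)) :=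
    measurable_one.indicator measurableSet_Ioi
  rw [hconv, ← lintegral_indicator_one measurableSet_Ioi, Measure.lintegral_conv hmeas,
    lintegral_map (by fun_prop) measurable_neg]
  refine lintegral_congr fun x ↦ ?_
  rw [ER, ← lintegral_indicator_one measurableSet_Ioi]
  refine lintegral_congr fun y ↦ ?_
  simp only [Set.indicator_apply, Set.mem_Ioi, lt_neg_add_iff_lt, Pi.one_apply]

open scoped NNReal in
lemma gaussianReal_Ioi_zero_eq (m : ℝ) (v : ℝ≥0) :
    gaussianReal m v (Set.Ioi 0) = gaussianReal 0 1 {x | 0 < √(v : ℝ) * x + m} := by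
  have hmap : gaussianReal m v = (gaussianReal 0 1).map fun x ↦ √(v : ℝ) * x + m := by
    change _ = (gaussianReal 0 1).map ((fun x ↦ x + m) ∘ fun x ↦ √(v : ℝ) * x)
    rw [← Measure.map_map (by fun_prop) (by fun_prop), gaussianReal_map_const_mul,
      gaussianReal_map_add_const]
    congr 1
    · simp
    · ext
      simp
  rw [hmap, Measure.map_apply (by fun_prop) measurableSet_Ioi]
  rfl

open scoped NNReal in
lemma gaussianReal_Ioi_zero_anti {m : ℝ} (hm : 0 ≤ m) {v w : ℝ≥0} (hv : 0 < v) (hvw : v ≤ w) :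
    gaussianReal m w (Set.Ioi 0) ≤ gaussianReal m v (Set.Ioi 0) := by
  rw [gaussianReal_Ioi_zero_eq, gaussianReal_Ioi_zero_eq]
  refine measure_mono fun x (hx : 0 < √(w : ℝ) * x + m) ↦ ?_
  change 0 < √(v : ℝ) * x + m
  have hle : √(v : ℝ) ≤ √(w : ℝ) := Real.sqrt_le_sqrt (by exact_mod_cast hvw)
  have hpos : 0 < √(v : ℝ) := Real.sqrt_pos.2 (by exact_mod_cast hv)
  rcases lt_or_ge 0 x with h | h
  · positivity
  · linarith [mul_le_mul_of_nonpos_right hle h]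

theorem perm_antitone_in_variances_of_mean_ge (mp mn : ℝ) (hm : mp ≤ mn)
    (v₁ v₂ : NNReal) (hv₁ : 0 < v₁) (hv₁₂ : v₁ ≤ v₂) :
    (∀ vp : NNReal, 0 < vp →
      PERM (gaussianReal mp vp) (gaussianReal mn v₂) ≤
        PERM (gaussianReal mp vp) (gaussianReal mn v₁)) ∧
    (∀ vn : NNReal, 0 < vn →
      PERM (gaussianReal mp v₂) (gaussianReal mn vn) ≤
        PERM (gaussianReal mp v₁) (gaussianReal mn vn)) := by
  have hd : 0 ≤ mn - mp := sub_nonneg.2 hm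
  simp only [PERM_gaussianReal]
  exact ⟨fun vp _ ↦ gaussianReal_Ioi_zero_anti hd (by positivity) (by gcongr),
    fun vn _ ↦ gaussianReal_Ioi_zero_anti hd (by positivity) (by gcongr)⟩
end

section
/- Let m₁, m₂ ∈ ℝ and v₁, v₂ > 0, and let T : ℝ → ℝ be the affine monotone transport map T(x) = m₂ + √(v₂ / v₁) · (x − m₁). Then the pushforward γ of N(m₁, v₁) under x ↦ (x, T x) is a coupling of N(m₁, v₁) and N(m₂, v₂), and its quadratic cost satisfies ∫ (x − y)² dγ(x, y) = (m₁ − m₂)² + (√v₁ − √v₂)². -/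
open MeasureTheory ProbabilityTheory

/-- `γ` is a coupling of `μ` and `ν`: its marginals are `μ` and `ν`. -/
def IsCoupling (γ : Measure (ℝ × ℝ)) (μ ν : Measure ℝ) : Prop :=
  γ.map Prod.fst = μ ∧ γ.map Prod.snd = ν

/-- Quadratic transport cost of a coupling. -/
noncomputable def quadCost (γ : Measure (ℝ × ℝ)) : ENNReal :=
  ∫⁻ p, ENNReal.ofReal ((p.1 - p.2) ^ 2) ∂γ

/-- Affine images of a Gaussian measure, with the source centred at its mean. -/
lemma gaussianReal_map_affine (m a s : ℝ) (v : NNReal) :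
    (gaussianReal m v).map (fun x => a + s * (x - m)) =
      gaussianReal a (Real.toNNReal (s ^ 2) * v) := by
  have h : (fun x : ℝ => a + s * (x - m)) = (fun x => (a - s * m) + x) ∘ (fun x => s * x) := by
    ext x
    simp only [Function.comp_apply]
    ring
  rw [h, ← Measure.map_map (by fun_prop) (by fun_prop), gaussianReal_map_const_mul,
    gaussianReal_map_const_add]
  congr 2
  · ring
  · exact (Real.toNNReal_of_nonneg (sq_nonneg s)).symm

/-- The second moment of a Gaussian measure. -/
lemma lintegral_sq_gaussianReal (m : ℝ) (v : NNReal) :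
    ∫⁻ x, ENNReal.ofReal (x ^ 2) ∂gaussianReal m v = ENNReal.ofReal (m ^ 2 + v) := by
  have hL : MemLp id 2 (gaussianReal m v) := memLp_id_gaussianReal 2
  have hint : Integrable (fun x : ℝ => x ^ 2) (gaussianReal m v) := hL.integrable_sq
  rw [← ofReal_integral_eq_lintegral_ofReal hint
    (Filter.Eventually.of_forall fun x => sq_nonneg x)]
  have hvar := variance_eq_sub hL
  simp only [variance_id_gaussianReal, Pi.pow_apply, id_eq, integral_id_gaussianReal] at hvar
  congr 1
  linarith

theorem gaussian_affine_transport_coupling (m₁ m₂ : ℝ) (v₁ v₂ : NNReal)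
    (hv₁ : 0 < v₁) (hv₂ : 0 < v₂) :
    IsCoupling
      ((gaussianReal m₁ v₁).map
        (fun x => (x, m₂ + Real.sqrt ((v₂ : ℝ) / (v₁ : ℝ)) * (x - m₁))))
      (gaussianReal m₁ v₁) (gaussianReal m₂ v₂) ∧
    quadCost
      ((gaussianReal m₁ v₁).map
        (fun x => (x, m₂ + Real.sqrt ((v₂ : ℝ) / (v₁ : ℝ)) * (x - m₁)))) =
      ENNReal.ofReal
        ((m₁ - m₂) ^ 2 + (Real.sqrt (v₁ : ℝ) - Real.sqrt (v₂ : ℝ)) ^ 2) := by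
  set s := Real.sqrt ((v₂ : ℝ) / (v₁ : ℝ)) with hs
  have hv₁' : (0 : ℝ) < v₁ := hv₁
  have hs_sq : s ^ 2 * (v₁ : ℝ) = v₂ := by
    rw [hs, Real.sq_sqrt (by positivity)]
    field_simp
  have hs_mul : s * Real.sqrt (v₁ : ℝ) = Real.sqrt (v₂ : ℝ) := by
    rw [hs, ← Real.sqrt_mul (by positivity), div_mul_cancel₀ _ hv₁'.ne']
  refine ⟨⟨?_, ?_⟩, ?_⟩
  · rw [Measure.map_map (by fun_prop) (by fun_prop)]
    exact Measure.map_id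
  · rw [Measure.map_map (by fun_prop) (by fun_prop)]
    refine (gaussianReal_map_affine m₁ m₂ s v₁).trans ?_
    congr 1
    ext
    simpa [Real.coe_toNNReal _ (sq_nonneg s)] using hs_sq
  · have hmap := gaussianReal_map_affine m₁ (m₁ - m₂) (1 - s) v₁
    have hvar : (1 - s) ^ 2 * (v₁ : ℝ) = (Real.sqrt v₁ - Real.sqrt v₂) ^ 2 := by
      rw [← hs_mul]
      linear_combination -(1 - s) ^ 2 * Real.sq_sqrt hv₁'.le
    rw [quadCost, lintegral_map (by fun_prop) (by fun_prop)]
    calc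
      _ = ∫⁻ x, ENNReal.ofReal ((m₁ - m₂ + (1 - s) * (x - m₁)) ^ 2) ∂gaussianReal m₁ v₁ := by
        congr with x
        congr 2
        ring
      _ = ∫⁻ y, ENNReal.ofReal (y ^ 2)
            ∂(gaussianReal m₁ v₁).map (fun x => m₁ - m₂ + (1 - s) * (x - m₁)) :=
        (lintegral_map (f := fun y : ℝ => ENNReal.ofReal (y ^ 2))
          (by fun_prop) (by fun_prop)).symm
      _ = _ := by
        rw [hmap, lintegral_sq_gaussianReal, NNReal.coe_mul,
          Real.coe_toNNReal _ (sq_nonneg _), hvar]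
end

section
/- Let m₁, m₂ ∈ ℝ and v₁, v₂ > 0. Every coupling γ of N(m₁, v₁) and N(m₂, v₂) satisfies ∫ (x − y)² dγ(x, y) ≥ (m₁ − m₂)² + (√v₁ − √v₂)² (with the integral taken in [0, ∞]). -/
open MeasureTheory ProbabilityTheory

/-- Cauchy-Schwarz for the covariance of square-integrable variables of positive variance. -/
lemma covariance_le_sqrt_variance_mul_sqrt_variance {Ω : Type*} {mΩ : MeasurableSpace Ω}
    {P : Measure Ω} [IsProbabilityMeasure P] {X Y : Ω → ℝ} (hX : MemLp X 2 P) (hY : MemLp Y 2 P)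
    (hX₀ : 0 < Var[X; P]) (hY₀ : 0 < Var[Y; P]) :
    cov[X, Y; P] ≤ √Var[X; P] * √Var[Y; P] := by
  have hs : 0 < √Var[X; P] * √Var[Y; P] := by positivity
  have h := variance_nonneg (√Var[Y; P] • X - √Var[X; P] • Y) P
  rw [variance_sub (hX.const_smul _) (hY.const_smul _), variance_smul, variance_smul,
    covariance_smul_left, covariance_smul_right, Real.sq_sqrt hX₀.le, Real.sq_sqrt hY₀.le] at h
  have hprod : (√Var[X; P] * √Var[Y; P]) * (√Var[X; P] * √Var[Y; P]) = Var[X; P] * Var[Y; P] := by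
    rw [mul_mul_mul_comm, Real.mul_self_sqrt hX₀.le, Real.mul_self_sqrt hY₀.le]
  exact le_of_mul_le_mul_left (by linarith) hs

/-- The mean square distance of two random variables is bounded below in terms of their means and
standard deviations. -/
lemma sq_sub_integral_add_sq_sub_sqrt_variance_le {Ω : Type*} {mΩ : MeasurableSpace Ω}
    {P : Measure Ω} [IsProbabilityMeasure P] {X Y : Ω → ℝ} (hX : MemLp X 2 P) (hY : MemLp Y 2 P)
    (hX₀ : 0 < Var[X; P]) (hY₀ : 0 < Var[Y; P]) :
    (P[X] - P[Y]) ^ 2 + (√Var[X; P] - √Var[Y; P]) ^ 2 ≤ P[(X - Y) ^ 2] := by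
  have hvar := variance_eq_sub (hX.sub hY)
  have hmean : P[X - Y] = P[X] - P[Y] :=
    integral_sub (hX.integrable (by norm_num)) (hY.integrable (by norm_num))
  rw [variance_sub hX hY, hmean] at hvar
  have hcov := covariance_le_sqrt_variance_mul_sqrt_variance hX hY hX₀ hY₀
  rw [sub_sq √Var[X; P], Real.sq_sqrt hX₀.le, Real.sq_sqrt hY₀.le]
  linarith

theorem gaussian_coupling_cost_lower_bound (m₁ m₂ : ℝ) (v₁ v₂ : NNReal)
    (hv₁ : 0 < v₁) (hv₂ : 0 < v₂) (γ : Measure (ℝ × ℝ))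
    (hγ : IsCoupling γ (gaussianReal m₁ v₁) (gaussianReal m₂ v₂)) :
    ENNReal.ofReal
        ((m₁ - m₂) ^ 2 + (Real.sqrt (v₁ : ℝ) - Real.sqrt (v₂ : ℝ)) ^ 2) ≤
      quadCost γ := by
  obtain ⟨h₁, h₂⟩ := hγ
  have : IsProbabilityMeasure (γ.map Prod.fst) := h₁ ▸ inferInstance
  have : IsProbabilityMeasure γ := Measure.isProbabilityMeasure_of_map Prod.fst
  have mp₁ : MeasurePreserving Prod.fst γ (gaussianReal m₁ v₁) := ⟨measurable_fst, h₁⟩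
  have mp₂ : MeasurePreserving Prod.snd γ (gaussianReal m₂ v₂) := ⟨measurable_snd, h₂⟩
  have L₁ : MemLp Prod.fst 2 γ :=
    (memLp_id_gaussianReal' 2 (by norm_num)).comp_measurePreserving mp₁
  have L₂ : MemLp Prod.snd 2 γ :=
    (memLp_id_gaussianReal' 2 (by norm_num)).comp_measurePreserving mp₂
  have e₁ : γ[Prod.fst] = m₁ := by
    rw [← integral_id_gaussianReal (μ := m₁) (v := v₁), ← h₁,
      integral_map measurable_fst.aemeasurable (by fun_prop)]
  have e₂ : γ[Prod.snd] = m₂ := by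
    rw [← integral_id_gaussianReal (μ := m₂) (v := v₂), ← h₂,
      integral_map measurable_snd.aemeasurable (by fun_prop)]
  have w₁ : Var[Prod.fst; γ] = v₁ := by
    rw [← variance_id_gaussianReal (μ := m₁) (v := v₁), ← h₁,
      variance_map (by fun_prop) (by fun_prop), Function.id_comp]
  have w₂ : Var[Prod.snd; γ] = v₂ := by
    rw [← variance_id_gaussianReal (μ := m₂) (v := v₂), ← h₂,
      variance_map (by fun_prop) (by fun_prop), Function.id_comp]
  have key := sq_sub_integral_add_sq_sub_sqrt_variance_le L₁ L₂
    (by rw [w₁]; exact_mod_cast hv₁) (by rw [w₂]; exact_mod_cast hv₂)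
  rw [e₁, e₂, w₁, w₂] at key
  have hint : quadCost γ = ENNReal.ofReal γ[((Prod.fst - Prod.snd) ^ 2 : ℝ × ℝ → ℝ)] :=
    (ofReal_integral_eq_lintegral_ofReal (L₁.sub L₂).integrable_sq
      (ae_of_all _ fun _ ↦ sq_nonneg _)).symm
  rw [hint]
  exact ENNReal.ofReal_le_ofReal key
end

section
/- For all m₁, m₂ ∈ ℝ and v₁, v₂ > 0, the squared 2-Wasserstein distance between the two Gaussians equals W₂²(N(m₁, v₁), N(m₂, v₂)) = (m₁ − m₂)² + (√v₁ − √v₂)², i.e., the infimum over couplings of the quadratic cost equals this value and is attained. -/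
open MeasureTheory ProbabilityTheory

/-- Squared 2-Wasserstein distance: infimum of the quadratic cost over couplings. -/
noncomputable def W2sq (μ ν : Measure ℝ) : ENNReal :=
  ⨅ (γ : Measure (ℝ × ℝ)) (_ : IsCoupling γ μ ν), quadCost γ

lemma covariance_sq_le_variance_mul_variance {Ω : Type*} {mΩ : MeasurableSpace Ω} {P : Measure Ω}
    [IsFiniteMeasure P] {X Y : Ω → ℝ} (hX : MemLp X 2 P) (hY : MemLp Y 2 P) :
    cov[X, Y; P] ^ 2 ≤ Var[X; P] * Var[Y; P] := by
  have h (t : ℝ) : 0 ≤ Var[Y; P] * (t * t) + (-2 * cov[X, Y; P]) * t + Var[X; P] := by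
    have := variance_nonneg (X - t • Y) P
    rw [variance_sub hX (hY.const_smul t), covariance_smul_right, variance_smul] at this
    linarith
  have := discrim_le_zero h
  rw [discrim] at this
  linarith

lemma sq_sub_sqrt_variance_le_variance_sub {Ω : Type*} {mΩ : MeasurableSpace Ω} {P : Measure Ω}
    [IsFiniteMeasure P] {X Y : Ω → ℝ} (hX : MemLp X 2 P) (hY : MemLp Y 2 P) :
    (√Var[X; P] - √Var[Y; P]) ^ 2 ≤ Var[X - Y; P] := by
  have hc := Real.le_sqrt_of_sq_le (covariance_sq_le_variance_mul_variance hX hY)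
  rw [Real.sqrt_mul (variance_nonneg X P)] at hc
  rw [variance_sub hX hY, sub_sq, Real.sq_sqrt (variance_nonneg X P),
    Real.sq_sqrt (variance_nonneg Y P)]
  linarith

lemma lintegral_ofReal_sq_eq_variance_add_sq_integral {Ω : Type*} {mΩ : MeasurableSpace Ω}
    {P : Measure Ω} [IsProbabilityMeasure P] {X : Ω → ℝ} (hX : MemLp X 2 P) :
    ∫⁻ ω, ENNReal.ofReal (X ω ^ 2) ∂P = ENNReal.ofReal (Var[X; P] + (∫ ω, X ω ∂P) ^ 2) := by
  rw [← ofReal_integral_eq_lintegral_ofReal hX.integrable_sq (.of_forall fun ω ↦ sq_nonneg (X ω)),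
    variance_eq_sub hX]
  simp

lemma le_quadCost_of_isCoupling {μ ν : Measure ℝ} [IsProbabilityMeasure μ]
    (hμ : MemLp id 2 μ) (hν : MemLp id 2 ν) {γ : Measure (ℝ × ℝ)} (hγ : IsCoupling γ μ ν) :
    ENNReal.ofReal ((∫ x, x ∂μ - ∫ y, y ∂ν) ^ 2 + (√Var[id; μ] - √Var[id; ν]) ^ 2) ≤
      quadCost γ := by
  obtain ⟨rfl, rfl⟩ := hγ
  have : IsProbabilityMeasure γ := Measure.isProbabilityMeasure_of_map Prod.fst
  have hX : MemLp Prod.fst 2 γ := hμ.comp_of_map measurable_fst.aemeasurable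
  have hY : MemLp Prod.snd 2 γ := hν.comp_of_map measurable_snd.aemeasurable
  have hcost := lintegral_ofReal_sq_eq_variance_add_sq_integral (hX.sub hY)
  simp only [Pi.sub_apply] at hcost
  rw [quadCost, hcost, integral_sub (hX.integrable one_le_two) (hY.integrable one_le_two),
    variance_id_map measurable_fst.aemeasurable, variance_id_map measurable_snd.aemeasurable,
    integral_map measurable_fst.aemeasurable (by fun_prop),
    integral_map measurable_snd.aemeasurable (by fun_prop), add_comm]
  gcongr
  exact sq_sub_sqrt_variance_le_variance_sub hX hY

lemma gaussianReal_zero_one_map_const_add_mul (m s : ℝ) :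
    (gaussianReal 0 1).map (fun z ↦ m + s * z) = gaussianReal m (.mk (s ^ 2) (sq_nonneg s)) := by
  have h := Measure.map_map (μ := gaussianReal 0 1) (measurable_const_add m)
    (measurable_const_mul s)
  rw [gaussianReal_map_const_mul, gaussianReal_map_const_add] at h
  simpa [Function.comp_def] using h.symm

/-- The coupling of two Gaussians obtained by driving both with the same standard Gaussian. -/
noncomputable def gaussianCoupling (m₁ m₂ : ℝ) (v₁ v₂ : NNReal) : Measure (ℝ × ℝ) :=
  (gaussianReal 0 1).map fun z ↦ (m₁ + √v₁ * z, m₂ + √v₂ * z)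

lemma isCoupling_gaussianCoupling (m₁ m₂ : ℝ) (v₁ v₂ : NNReal) :
    IsCoupling (gaussianCoupling m₁ m₂ v₁ v₂) (gaussianReal m₁ v₁) (gaussianReal m₂ v₂) := by
  have hv (v : NNReal) : NNReal.mk (√v ^ 2) (sq_nonneg _) = v :=
    NNReal.eq (Real.sq_sqrt v.coe_nonneg)
  constructor
  · rw [gaussianCoupling, Measure.map_map measurable_fst (by fun_prop)]
    exact (gaussianReal_zero_one_map_const_add_mul m₁ √v₁).trans (by rw [hv])
  · rw [gaussianCoupling, Measure.map_map measurable_snd (by fun_prop)]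
    exact (gaussianReal_zero_one_map_const_add_mul m₂ √v₂).trans (by rw [hv])

lemma quadCost_gaussianCoupling (m₁ m₂ : ℝ) (v₁ v₂ : NNReal) :
    quadCost (gaussianCoupling m₁ m₂ v₁ v₂) =
      ENNReal.ofReal ((m₁ - m₂) ^ 2 + (√v₁ - √v₂) ^ 2) := by
  have hsub (z : ℝ) : m₁ + √v₁ * z - (m₂ + √v₂ * z) = m₁ - m₂ + (√v₁ - √v₂) * z := by ring
  rw [quadCost, gaussianCoupling, lintegral_map (by fun_prop) (by fun_prop)]
  simp only [hsub]
  rw [← lintegral_map (μ := gaussianReal 0 1) (f := fun x : ℝ ↦ ENNReal.ofReal (x ^ 2))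
    (g := fun z ↦ m₁ - m₂ + (√v₁ - √v₂) * z) (by fun_prop) (by fun_prop),
    gaussianReal_zero_one_map_const_add_mul]
  have h := lintegral_ofReal_sq_eq_variance_add_sq_integral (memLp_id_gaussianReal
    (μ := m₁ - m₂) (v := .mk ((√v₁ - √v₂) ^ 2) (sq_nonneg _)) 2)
  simp only [variance_id_gaussianReal, id_eq, integral_id_gaussianReal, NNReal.coe_mk] at h
  rw [h, add_comm]

theorem gaussian_W2sq_closed_form (m₁ m₂ : ℝ) (v₁ v₂ : NNReal)
    (hv₁ : 0 < v₁) (hv₂ : 0 < v₂) :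
    W2sq (gaussianReal m₁ v₁) (gaussianReal m₂ v₂) =
      ENNReal.ofReal
        ((m₁ - m₂) ^ 2 + (Real.sqrt (v₁ : ℝ) - Real.sqrt (v₂ : ℝ)) ^ 2) ∧
    ∃ γ : Measure (ℝ × ℝ), IsCoupling γ (gaussianReal m₁ v₁) (gaussianReal m₂ v₂) ∧
      quadCost γ =
        ENNReal.ofReal
          ((m₁ - m₂) ^ 2 + (Real.sqrt (v₁ : ℝ) - Real.sqrt (v₂ : ℝ)) ^ 2) := by
  have hcoupling := isCoupling_gaussianCoupling m₁ m₂ v₁ v₂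
  have hcost := quadCost_gaussianCoupling m₁ m₂ v₁ v₂
  refine ⟨le_antisymm (hcost ▸ iInf₂_le (gaussianCoupling m₁ m₂ v₁ v₂) hcoupling)
    (le_iInf₂ fun γ hγ ↦ ?_),
    _, hcoupling, hcost⟩
  simpa using le_quadCost_of_isCoupling (memLp_id_gaussianReal 2) (memLp_id_gaussianReal 2) hγ
end

section
/- (Monotone increasing correspondence between KP and PERM, deviation above.) Fix m⁺ ∈ ℝ and v⁺, v⁻ > 0, and for m ∈ ℝ set KP(m) = W₂²(N(m⁺, v⁺), N(m, v⁻)) and P(m) = PERM(N(m⁺, v⁺), N(m, v⁻)). Then for all m₁, m₂ with m₁ ≥ m⁺ and m₂ ≥ m⁺: KP(m₁) ≤ KP(m₂) if and only if P(m₁) ≤ P(m₂). -/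
open MeasureTheory ProbabilityTheory

theorem IsCoupling.isProbabilityMeasure {γ : Measure (ℝ × ℝ)} {μ ν : Measure ℝ}
    [IsProbabilityMeasure μ] (h : IsCoupling γ μ ν) : IsProbabilityMeasure γ := by
  have : IsProbabilityMeasure (γ.map Prod.fst) := by rw [h.1]; infer_instance
  exact Measure.isProbabilityMeasure_of_map Prod.fst

theorem IsCoupling.memLp_fst_sub_snd {γ : Measure (ℝ × ℝ)} {μ ν : Measure ℝ}
    (h : IsCoupling γ μ ν) (hμ : MemLp id 2 μ) (hν : MemLp id 2 ν) :
    MemLp (fun p : ℝ × ℝ => p.1 - p.2) 2 γ := by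
  rw [← h.1] at hμ
  rw [← h.2] at hν
  have hfst := (memLp_map_measure_iff (by fun_prop) (by fun_prop)).1 hμ
  have hsnd := (memLp_map_measure_iff (by fun_prop) (by fun_prop)).1 hν
  exact hfst.sub hsnd

/-- The cost of a coupling splits into a variance and the squared difference of the means. -/
theorem IsCoupling.quadCost_eq {γ : Measure (ℝ × ℝ)} {μ ν : Measure ℝ}
    [IsProbabilityMeasure μ] (h : IsCoupling γ μ ν) (hμ : MemLp id 2 μ) (hν : MemLp id 2 ν) :
    quadCost γ = ENNReal.ofReal (Var[fun p : ℝ × ℝ => p.1 - p.2; γ]) +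
      ENNReal.ofReal ((∫ x, x ∂μ - ∫ y, y ∂ν) ^ 2) := by
  have := h.isProbabilityMeasure
  have hL := h.memLp_fst_sub_snd hμ hν
  have hfst : Integrable (fun p : ℝ × ℝ => p.1) γ := by
    rw [← h.1] at hμ
    exact ((memLp_map_measure_iff (by fun_prop) (by fun_prop)).1 hμ).integrable (by norm_num)
  have hsnd : Integrable (fun p : ℝ × ℝ => p.2) γ := by
    rw [← h.2] at hν
    exact ((memLp_map_measure_iff (by fun_prop) (by fun_prop)).1 hν).integrable (by norm_num)
  have hmean : ∫ p : ℝ × ℝ, (p.1 - p.2) ∂γ = ∫ x, x ∂μ - ∫ y, y ∂ν := by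
    rw [integral_sub hfst hsnd, ← h.1, ← h.2, integral_map (by fun_prop) (by fun_prop),
      integral_map (by fun_prop) (by fun_prop)]
  rw [← ENNReal.ofReal_add (variance_nonneg _ _) (sq_nonneg _), variance_eq_sub hL, hmean,
    sub_add_cancel, quadCost,
    ← ofReal_integral_eq_lintegral_ofReal hL.integrable_sq (.of_forall fun _ => sq_nonneg _)]
  rfl

/-- Translating the second marginal does not change the variance of the difference. -/
theorem IsCoupling.exists_translate {γ : Measure (ℝ × ℝ)} {μ : Measure ℝ} [IsProbabilityMeasure μ]
    {m : ℝ} {v : NNReal} (h : IsCoupling γ μ (gaussianReal m v)) (m' : ℝ) :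
    ∃ γ', IsCoupling γ' μ (gaussianReal m' v) ∧
      Var[fun p : ℝ × ℝ => p.1 - p.2; γ'] = Var[fun p : ℝ × ℝ => p.1 - p.2; γ] := by
  have hT : Measurable fun p : ℝ × ℝ => (p.1, p.2 + (m' - m)) := by fun_prop
  refine ⟨γ.map fun p => (p.1, p.2 + (m' - m)), ⟨?_, ?_⟩, ?_⟩
  · rw [Measure.map_map measurable_fst hT]
    exact h.1
  · rw [Measure.map_map measurable_snd hT]
    change γ.map ((· + (m' - m)) ∘ Prod.snd) = _
    rw [← Measure.map_map (by fun_prop) measurable_snd, h.2, gaussianReal_map_add_const]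
    congr 1
    ring
  · have := h.isProbabilityMeasure
    rw [variance_map (by fun_prop) hT.aemeasurable,
      ← variance_sub_const (X := fun p : ℝ × ℝ => p.1 - p.2) (by fun_prop) (m' - m)]
    congr 1
    ext p
    simp only [Function.comp_apply]
    ring

theorem W2sq_gaussianReal_eq (mp m : ℝ) (vp vn : NNReal) :
    W2sq (gaussianReal mp vp) (gaussianReal m vn) =
      W2sq (gaussianReal mp vp) (gaussianReal mp vn) + ENNReal.ofReal ((mp - m) ^ 2) := by
  have hL (a : ℝ) (v : NNReal) : MemLp id 2 (gaussianReal a v) := memLp_id_gaussianReal 2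
  apply le_antisymm
  · simp only [W2sq, ENNReal.iInf_add]
    refine le_iInf₂ fun γ h => ?_
    obtain ⟨γ', h', hvar⟩ := h.exists_translate m
    refine (iInf₂_le γ' h').trans_eq ?_
    rw [h'.quadCost_eq (hL _ _) (hL _ _), h.quadCost_eq (hL _ _) (hL _ _), hvar]
    simp [integral_id_gaussianReal]
  · refine le_iInf₂ fun γ h => ?_
    obtain ⟨γ', h', hvar⟩ := h.exists_translate mp
    have hle : W2sq (gaussianReal mp vp) (gaussianReal mp vn) ≤ quadCost γ' := iInf₂_le γ' h'
    refine (add_le_add_left hle _).trans_eq ?_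
    rw [h'.quadCost_eq (hL _ _) (hL _ _), h.quadCost_eq (hL _ _) (hL _ _), hvar]
    simp [integral_id_gaussianReal]

theorem isCoupling_prod (μ ν : Measure ℝ) [IsProbabilityMeasure μ] [IsProbabilityMeasure ν] :
    IsCoupling (μ.prod ν) μ ν :=
  ⟨by simp [Measure.map_fst_prod], by simp [Measure.map_snd_prod]⟩

theorem W2sq_ne_top {μ ν : Measure ℝ} [IsProbabilityMeasure μ] [IsProbabilityMeasure ν]
    (hμ : MemLp id 2 μ) (hν : MemLp id 2 ν) : W2sq μ ν ≠ ⊤ := by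
  have h := isCoupling_prod μ ν
  refine ne_top_of_le_ne_top (b := quadCost (μ.prod ν)) ?_ (iInf₂_le (μ.prod ν) h)
  simp [h.quadCost_eq hμ hν]

theorem strictMonoOn_W2sq_gaussianReal (mp : ℝ) (vp vn : NNReal) :
    StrictMonoOn (fun m => W2sq (gaussianReal mp vp) (gaussianReal m vn)) (Set.Ici mp) := by
  intro a ha b hb hab
  simp only [Set.mem_Ici] at ha hb
  dsimp only
  rw [W2sq_gaussianReal_eq mp a, W2sq_gaussianReal_eq mp b]
  refine ENNReal.add_lt_add_left
    (W2sq_ne_top (memLp_id_gaussianReal 2) (memLp_id_gaussianReal 2)) ?_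
  exact (ENNReal.ofReal_lt_ofReal_iff (by nlinarith)).2 (by nlinarith)

theorem measurable_ER (μ : Measure ℝ) : Measurable (ER μ) :=
  Antitone.measurable fun _ _ h => measure_mono (Set.Ioi_subset_Ioi h)

theorem ER_gaussianReal (m : ℝ) (v : NNReal) (x : ℝ) :
    ER (gaussianReal m v) x = gaussianReal 0 v (Set.Ioi (x - m)) := by
  have h : (gaussianReal 0 v).map (· + m) = gaussianReal m v := by
    rw [gaussianReal_map_add_const, zero_add]
  rw [ER, ← h, Measure.map_apply (by fun_prop) measurableSet_Ioi]
  congr 1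
  ext y
  simp [sub_lt_iff_lt_add]

theorem ER_gaussianReal_lt {v : NNReal} (hv : v ≠ 0) {a b : ℝ} (hab : a < b) (x : ℝ) :
    ER (gaussianReal a v) x < ER (gaussianReal b v) x := by
  rw [ER_gaussianReal, ER_gaussianReal, ← Set.Ioc_union_Ioi_eq_Ioi (by linarith : x - b ≤ x - a),
    measure_union (Set.Ioc_disjoint_Ioi le_rfl) measurableSet_Ioi, add_comm]
  refine ENNReal.lt_add_right (measure_ne_top _ _) fun h0 => ?_
  have := gaussianReal_absolutelyContinuous' 0 hv h0
  simp at this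
  linarith

theorem strictMono_PERM_gaussianReal (μ : Measure ℝ) [IsProbabilityMeasure μ] {v : NNReal}
    (hv : v ≠ 0) : StrictMono fun m => PERM μ (gaussianReal m v) := by
  intro a b hab
  refine lintegral_strict_mono (IsProbabilityMeasure.ne_zero μ) (measurable_ER _).aemeasurable ?_
    (.of_forall (ER_gaussianReal_lt hv hab))
  refine ne_top_of_le_ne_top ENNReal.one_ne_top ((lintegral_mono fun _ => prob_le_one).trans ?_)
  simp

theorem kp_perm_monotone_correspondence_above (mp : ℝ) (vp vn : NNReal)
    (hvp : 0 < vp) (hvn : 0 < vn) (m₁ m₂ : ℝ) (h₁ : mp ≤ m₁) (h₂ : mp ≤ m₂) :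
    W2sq (gaussianReal mp vp) (gaussianReal m₁ vn) ≤
        W2sq (gaussianReal mp vp) (gaussianReal m₂ vn) ↔
      PERM (gaussianReal mp vp) (gaussianReal m₁ vn) ≤
        PERM (gaussianReal mp vp) (gaussianReal m₂ vn) := by
  exact ((strictMonoOn_W2sq_gaussianReal mp vp vn).le_iff_le h₁ h₂).trans
    (strictMono_PERM_gaussianReal _ hvn.ne').le_iff_le.symm
end

section
/- For any probability measures μ⁺ and μ⁻ on ℝ, the map t ↦ PERM(μ⁺, μ⁻ translated by t) is monotone nondecreasing in t, where μ⁻ translated by t denotes the pushforward of μ⁻ under x ↦ x + t; that is, if t₁ ≤ t₂ then PERM(μ⁺, μ⁻.map(· + t₁)) ≤ PERM(μ⁺, μ⁻.map(· + t₂)). -/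
open MeasureTheory ProbabilityTheory

theorem perm_mono_in_translation (μp μn : Measure ℝ)
    [IsProbabilityMeasure μp] [IsProbabilityMeasure μn]
    (t₁ t₂ : ℝ) (h : t₁ ≤ t₂) :
    PERM μp (μn.map (· + t₁)) ≤ PERM μp (μn.map (· + t₂)) := by
  refine lintegral_mono fun x => ?_
  simp only [ER]
  rw [Measure.map_apply (measurable_add_const t₁) measurableSet_Ioi,
    Measure.map_apply (measurable_add_const t₂) measurableSet_Ioi]
  refine measure_mono fun y hy => ?_
  simp only [Set.mem_preimage, Set.mem_Ioi] at hy ⊢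
  linarith
end

section
/- (Gaussian noise stability of KP.) For all m_μ, m_ν ∈ ℝ, v_μ, v_ν > 0 and every noise variance s ≥ 0, adding independent zero-mean Gaussian noise of variance s to both the positive and negative score distributions does not increase their squared 2-Wasserstein distance: W₂²(N(m_μ, v_μ + s), N(m_ν, v_ν + s)) ≤ W₂²(N(m_μ, v_μ), N(m_ν, v_ν)). -/
open MeasureTheory ProbabilityTheory

/-- A coupling with a finite first marginal is a finite measure. -/
lemma IsCoupling.isFiniteMeasure {γ : Measure (ℝ × ℝ)} {μ ν : Measure ℝ} [IsFiniteMeasure μ]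
    (h : IsCoupling γ μ ν) : IsFiniteMeasure γ := by
  refine ⟨?_⟩
  rw [← Set.preimage_univ (f := Prod.fst), ← Measure.map_apply measurable_fst MeasurableSet.univ,
    h.1]
  exact measure_lt_top μ _

/-- Adding the same independent noise to both coordinates of a coupling of `μ` and `ν` gives a
coupling of the convolutions. -/
lemma IsCoupling.addNoise {γ : Measure (ℝ × ℝ)} {μ ν : Measure ℝ} [SFinite γ]
    (h : IsCoupling γ μ ν) (ρ : Measure ℝ) [SFinite ρ] :
    IsCoupling ((γ.prod ρ).map fun q ↦ (q.1.1 + q.2, q.1.2 + q.2)) (μ ∗ ρ) (ν ∗ ρ) := by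
  constructor
  · rw [Measure.map_map (by fun_prop) (by fun_prop), ← h.1, Measure.conv]
    nth_rw 2 [← Measure.map_id (μ := ρ)]
    rw [Measure.map_prod_map _ _ measurable_fst measurable_id,
      Measure.map_map (by fun_prop) (by fun_prop)]
    rfl
  · rw [Measure.map_map (by fun_prop) (by fun_prop), ← h.2, Measure.conv]
    nth_rw 2 [← Measure.map_id (μ := ρ)]
    rw [Measure.map_prod_map _ _ measurable_snd measurable_id,
      Measure.map_map (by fun_prop) (by fun_prop)]
    rfl

/-- Adding the same independent noise to both coordinates preserves the quadratic cost. -/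
lemma quadCost_addNoise (γ : Measure (ℝ × ℝ)) [SFinite γ] (ρ : Measure ℝ)
    [IsProbabilityMeasure ρ] :
    quadCost ((γ.prod ρ).map fun q ↦ (q.1.1 + q.2, q.1.2 + q.2)) = quadCost γ := by
  simp only [quadCost]
  rw [lintegral_map (by fun_prop) (by fun_prop), lintegral_prod _ (by fun_prop)]
  simp

/-- Convolving both measures with a common probability measure does not increase `W2sq`. -/
lemma W2sq_conv_le (μ ν ρ : Measure ℝ) [IsFiniteMeasure μ] [IsProbabilityMeasure ρ] :
    W2sq (μ ∗ ρ) (ν ∗ ρ) ≤ W2sq μ ν := by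
  refine le_iInf₂ fun γ hγ ↦ ?_
  have := hγ.isFiniteMeasure
  rw [← quadCost_addNoise γ ρ]
  exact iInf₂_le (f := fun γ _ ↦ quadCost γ) _ (hγ.addNoise ρ)

theorem w2sq_gaussian_noise_stability (mμ mν : ℝ) (vμ vν : NNReal)
    (hvμ : 0 < vμ) (hvν : 0 < vν) (s : NNReal) (hs : 0 ≤ s) :
    W2sq (gaussianReal mμ (vμ + s)) (gaussianReal mν (vν + s)) ≤
      W2sq (gaussianReal mμ vμ) (gaussianReal mν vν) := by
  simpa only [gaussianReal_conv_gaussianReal, add_zero] using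
    W2sq_conv_le (gaussianReal mμ vμ) (gaussianReal mν vν) (gaussianReal 0 s)
end
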